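/- Let f* : D → C be a coproduct-preserving tensor-exact functor between rigidly-compactly generated tensor-triangulated categories, with right adjoint f_*. Then: (a) f* satisfies Grothendieck-Neeman duality (i.e. f_* preserves compact objects) if and only if C^c ⊆ f^#(D^c); (b) if C^c = f^#(D^c), then the relative dualizing object ω := f^(1)(𝟙) is ⊗-invertible (the Wirthmüller isomorphism holds). -/

import Mathlib

/-!
Formalization of statements from "Grothendieck-Neeman duality and the
Wirthmüller isomorphism" by Balmer, Dell'Ambrogio and Sanders.
-/

noncomputable section

open CategoryTheory CategoryTheory.Limits CategoryTheory.Pretriangulated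
  CategoryTheory.MonoidalCategory CategoryTheory.MonoidalClosed Opposite

universe v u u₁ u₂ u₃

namespace GN

section Compact

variable {C : Type u} [Category.{v} C]

/-- An object `t` is compact if `Hom(t, -)`, viewed as a functor to abelian groups,
preserves small coproducts. -/
def IsCompactObj [Preadditive C] (t : C) : Prop :=
  ∀ J : Type v, Nonempty (PreservesColimitsOfShape (Discrete J)
    (preadditiveCoyoneda.obj (op t)))

/-- A functor preserves arbitrary (small) coproducts. -/
def PreservesCoproducts {D : Type u₂} [Category.{v} D] (F : C ⥤ D) : Prop :=
  ∀ J : Type v, Nonempty (PreservesColimitsOfShape (Discrete J) F)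

/-- A functor preserves arbitrary (small) products. -/
def PreservesProducts {D : Type u₂} [Category.{v} D] (F : C ⥤ D) : Prop :=
  ∀ J : Type v, Nonempty (PreservesLimitsOfShape (Discrete J) F)

/-- A compactly generated category: it admits all small coproducts and
has a set of compact generators. -/
structure CompactlyGenerated (C : Type u) [Category.{v} C] [Preadditive C] : Prop where
  hasCoproducts : HasCoproducts.{v} C
  exists_generators : ∃ (ι : Type v) (G : ι → C), (∀ i, IsCompactObj (G i)) ∧
    ∀ t : C, (∀ (i : ι) (f : G i ⟶ t), f = 0) → IsZero t

end Compact

section Tensor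

variable {C : Type u} [Category.{v} C] [MonoidalCategory C] [MonoidalClosed C]

/-- The canonical map `hom(x,𝟙) ⊗ y ⟶ hom(x,y)`. -/
def rigidComparison (x y : C) : (ihom x).obj (𝟙_ C) ⊗ y ⟶ (ihom x).obj y :=
  MonoidalClosed.curry ((α_ x ((ihom x).obj (𝟙_ C)) y).inv ≫
    (((ihom.ev x).app (𝟙_ C)) ▷ y) ≫ (λ_ y).hom)

/-- An object `x` is rigid if `hom(x,𝟙) ⊗ y ⟶ hom(x,y)` is an isomorphism for all `y`. -/
def IsRigid (x : C) : Prop := ∀ y : C, IsIso (rigidComparison x y)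

/-- An object `u` is `⊗`-invertible if `u ⊗ v ≅ 𝟙` for some `v`. -/
def TensorInvertible (u : C) : Prop := ∃ v : C, Nonempty (u ⊗ v ≅ 𝟙_ C)

/-- The `κ`-twisted duality functor `D_κ = hom(-,κ)`. -/
@[reducible] def Dfun (κ : C) : Cᵒᵖ ⥤ C := MonoidalClosed.internalHom.flip.obj κ

/-- The canonical double-duality map `ϖ : x ⟶ D_κ D_κ (x)`, i.e. the unit/counit of the
self-adjunction of `D_κ = hom(-,κ)`. -/
def varpi [BraidedCategory C] (κ x : C) : x ⟶ (ihom ((ihom x).obj κ)).obj κ :=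
  MonoidalClosed.curry ((β_ ((ihom x).obj κ) x).hom ≫ (ihom.ev x).app κ)

/-- A rigidly-compactly generated tensor-triangulated category: it admits all small
coproducts, its compact objects coincide with its rigid objects, and it has a set of
compact generators. -/
structure RigidlyCompactlyGenerated (C : Type u) [Category.{v} C] [Preadditive C]
    [MonoidalCategory C] [MonoidalClosed C] : Prop where
  hasCoproducts : HasCoproducts.{v} C
  compact_iff_rigid : ∀ x : C, IsCompactObj x ↔ IsRigid x
  exists_generators : ∃ (ι : Type v) (G : ι → C), (∀ i, IsCompactObj (G i)) ∧
    ∀ t : C, (∀ (i : ι) (f : G i ⟶ t), f = 0) → IsZero t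

end Tensor

section Triang

variable {C : Type u} [Category.{v} C] [HasZeroObject C] [Preadditive C] [HasShift C ℤ]
  [∀ n : ℤ, (shiftFunctor C n).Additive] [Pretriangulated C]

/-- A thick triangulated subcategory, given as a predicate on objects:
it contains the zero objects, and is closed under shifts, cones and direct summands
(hence in particular under isomorphisms). -/
structure IsThickSubcategory (S : Set C) : Prop where
  zero : ∀ x : C, IsZero x → x ∈ S
  shift : ∀ x ∈ S, ∀ n : ℤ, x⟦n⟧ ∈ S
  ext₃ : ∀ T : Triangle C, (T ∈ distTriang C) → T.obj₁ ∈ S → T.obj₂ ∈ S → T.obj₃ ∈ S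
  retract : ∀ x y : C, (∃ (s : x ⟶ y) (r : y ⟶ x), s ≫ r = 𝟙 x) → y ∈ S → x ∈ S

/-- The thick subcategory generated by a set of objects. -/
def thickClosure (S : Set C) : Set C :=
  { x | ∀ T : Set C, IsThickSubcategory T → S ⊆ T → x ∈ T }

/-- A `C^c`-submodule of `C`: a thick triangulated subcategory which is closed under
tensoring with compact objects. -/
structure IsSubmodule [MonoidalCategory C] (S : Set C) extends IsThickSubcategory S : Prop where
  smul : ∀ c x : C, IsCompactObj c → x ∈ S → (c ⊗ x) ∈ S

end Triang

section Dual

variable {C : Type u} [Category.{v} C] [MonoidalCategory C] [BraidedCategory C]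
  [MonoidalClosed C]

/-- `κ` is a (possibly external) dualizing object for `S ⊆ C`: the `κ`-twisted
duality `D_κ = hom(-,κ)` preserves `S` and every object of `S` is `κ`-reflexive;
equivalently, `D_κ` restricts to an anti-equivalence `S^op ≃ S`. -/
structure IsExternalDualizing (S : Set C) (κ : C) : Prop where
  stable : ∀ x ∈ S, (ihom x).obj κ ∈ S
  reflexive : ∀ x ∈ S, IsIso (varpi κ x)

/-- `κ ∈ S` is a dualizing object for `S`. -/
structure IsDualizing (S : Set C) (κ : C) extends IsExternalDualizing S κ : Prop where
  mem : κ ∈ S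

end Dual

section Pullback

variable {C : Type u₁} {D : Type u₂} [Category.{v} C] [Category.{v} D]
  [Preadditive C] [MonoidalCategory C]

/-- The compact pull-back `f^#(D₀)` of a subcategory `D₀ ⊆ D` along `f_* : C ⥤ D`. -/
def compactPullback (fpush : C ⥤ D) (D₀ : Set D) : Set C :=
  { x | ∀ c : C, IsCompactObj c → fpush.obj (c ⊗ x) ∈ D₀ }

end Pullback

section Proj

variable {D : Type u₁} {C : Type u₂} [Category.{v} D] [Category.{v} C]
  [MonoidalCategory D] [MonoidalCategory C]

/-- The canonical projection formula map `π : x ⊗ f_*(y) ⟶ f_*(f^*(x) ⊗ y)`,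
obtained by adjunction from `f^*(x ⊗ f_* y) ≅ f^* x ⊗ f^* f_* y → f^* x ⊗ y`. -/
def projFormula (fstar : D ⥤ C) [fstar.Monoidal] (fpush : C ⥤ D) (adj : fstar ⊣ fpush)
    (x : D) (y : C) : x ⊗ fpush.obj y ⟶ fpush.obj (fstar.obj x ⊗ y) :=
  (adj.homEquiv _ _)
    (Functor.OplaxMonoidal.δ fstar x (fpush.obj y) ≫ (fstar.obj x ◁ adj.counit.app y))

/-- The canonical comparison map `f^(1)(x) ⊗ f^*(y) ⟶ f^(1)(x ⊗ y)`, obtained by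
adjunction from the counit `f_* f^(1) → Id` via the projection formula. -/
def gnComparison [BraidedCategory D] [BraidedCategory C] (fstar : D ⥤ C) [fstar.Monoidal]
    (fpush : C ⥤ D) (adj1 : fstar ⊣ fpush) (fone : D ⥤ C) (adj2 : fpush ⊣ fone)
    (hπ : ∀ (x : D) (y : C), IsIso (projFormula fstar fpush adj1 x y)) (x y : D) :
    fone.obj x ⊗ fstar.obj y ⟶ fone.obj (x ⊗ y) :=
  haveI := hπ y (fone.obj x)
  (adj2.homEquiv _ _)
    (fpush.map (β_ (fone.obj x) (fstar.obj y)).hom ≫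
      inv (projFormula fstar fpush adj1 y (fone.obj x)) ≫
      (β_ y (fpush.obj (fone.obj x))).hom ≫ (adj2.counit.app x ▷ y))

end Proj

open ExactPairing Functor.LaxMonoidal Functor.OplaxMonoidal

section Rigid

variable {C : Type u} [Category.{v} C] [MonoidalCategory C]

lemma zigzag_of_zigzag {x y : C} (η : 𝟙_ C ⟶ y ⊗ x) (ε : x ⊗ y ⟶ 𝟙_ C)
    (h : x ◁ η ≫ (α_ _ _ _).inv ≫ ε ▷ x = (ρ_ x).hom ≫ (λ_ x).inv) :
    x ◁ ((η ▷ y ≫ (α_ _ _ _).hom ≫ y ◁ ε) ≫ (ρ_ y).hom) ≫ ε = x ◁ (λ_ y).hom ≫ ε :=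
  calc
    _ = x ◁ η ▷ y ⊗≫ ((x ⊗ y) ◁ ε ≫ ε ▷ 𝟙_ C) ⊗≫ 𝟙 _ := by monoidal
    _ = 𝟙 _ ⊗≫ (x ◁ η ≫ (α_ _ _ _).inv ≫ ε ▷ x) ▷ y ⊗≫ ε := by
      rw [whisker_exchange]; monoidal
    _ = _ := by rw [h]; monoidal

variable [MonoidalClosed C]

/-- A rigid object `x` has left dual `hom(x, 𝟙)`. -/
@[reducible]
def IsRigid.exactPairing {x : C} (hx : IsRigid x) : ExactPairing ((ihom x).obj (𝟙_ C)) x := by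
  haveI := hx x
  let η : 𝟙_ C ⟶ (ihom x).obj (𝟙_ C) ⊗ x :=
    MonoidalClosed.curry (ρ_ x).hom ≫ inv (rigidComparison x x)
  have h : x ◁ η ≫ (α_ _ _ _).inv ≫ (ihom.ev x).app (𝟙_ C) ▷ x = (ρ_ x).hom ≫ (λ_ x).inv := by
    have h₁ : η ≫ rigidComparison x x = MonoidalClosed.curry (ρ_ x).hom := by simp [η]
    rw [rigidComparison, ← MonoidalClosed.curry_natural_left] at h₁
    have h₂ := MonoidalClosed.curry_injective h₁
    rw [← cancel_mono (λ_ x).hom]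
    simpa using h₂
  exact
    { coevaluation' := η
      evaluation' := (ihom.ev x).app (𝟙_ C)
      coevaluation_evaluation' := h
      evaluation_coevaluation' := by
        rw [← cancel_mono (ρ_ _).hom]
        apply MonoidalClosed.uncurry_injective
        rw [MonoidalClosed.uncurry_eq, MonoidalClosed.uncurry_eq]
        simpa [unitors_equal] using zigzag_of_zigzag η _ h }

/-- An object with a left dual is rigid. -/
lemma isRigid_of_exactPairing (y x : C) [ExactPairing y x] : IsRigid x := by
  have h : ∀ z : C, IsIso (MonoidalClosed.curry ((α_ x y z).inv ≫ ε_ y x ▷ z ≫ (λ_ z).hom)) := by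
    intro z
    have := Adjunction.homEquiv_symm_rightAdjointUniq_hom_app
      (tensorLeftAdjunction y x) (ihom.adjunction x) z
    rw [Equiv.symm_apply_eq] at this
    have h₂ : (tensorLeftAdjunction y x).counit.app z =
      (α_ x y z).inv ≫ ε_ y x ▷ z ≫ (λ_ z).hom := by
      simp [tensorLeftAdjunction, Adjunction.mkOfHomEquiv, tensorLeftHomEquiv]
    rw [h₂] at this
    change IsIso ((ihom.adjunction x).homEquiv ((tensorLeft y).obj z) z
      ((α_ x y z).inv ≫ ε_ y x ▷ z ≫ (λ_ z).hom))
    rw [← this]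
    infer_instance
  intro z
  have := h z
  have := h (𝟙_ C)
  have hc : MonoidalClosed.curry ((α_ x y (𝟙_ C)).inv ≫ ε_ y x ▷ (𝟙_ C) ≫ (λ_ (𝟙_ C)).hom) ▷ z ≫
      rigidComparison x z = (ρ_ y).hom ▷ z ≫
        MonoidalClosed.curry ((α_ x y z).inv ≫ ε_ y x ▷ z ≫ (λ_ z).hom) := by
    apply MonoidalClosed.uncurry_injective
    rw [rigidComparison, ← MonoidalClosed.curry_natural_left, ← MonoidalClosed.curry_natural_left,
      MonoidalClosed.uncurry_curry, MonoidalClosed.uncurry_curry,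
      associator_inv_naturality_middle_assoc, ← comp_whiskerRight_assoc,
      MonoidalClosed.whiskerLeft_curry_ihom_ev_app]
    monoidal
  rw [← IsIso.eq_inv_comp] at hc
  rw [hc]
  infer_instance

end Rigid

section Detection

variable {C : Type u} [Category.{v} C]

lemma IsCompactObj.of_iso [Preadditive C] {x y : C} (e : x ≅ y) (hx : IsCompactObj x) :
    IsCompactObj y := fun J => by
  obtain ⟨h⟩ := hx J
  exact ⟨preservesColimitsOfShape_of_natIso (preadditiveCoyoneda.mapIso e.symm.op)⟩

variable [Preadditive C] [HasShift C ℤ] [∀ n : ℤ, (shiftFunctor C n).Additive]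

lemma IsCompactObj.shift {x : C} (hx : IsCompactObj x) (n : ℤ) : IsCompactObj (x⟦n⟧) := fun J => by
  obtain ⟨h⟩ := hx J
  have : (shiftEquiv C n).functor.Additive := inferInstanceAs (shiftFunctor C n).Additive
  let e : shiftFunctor C (-n) ⋙ preadditiveCoyoneda.obj (op x) ≅
      preadditiveCoyoneda.obj (op (x⟦n⟧)) :=
    NatIso.ofComponents (fun y =>
      AddEquiv.toAddCommGrpIso ((shiftEquiv C n).toAdjunction.homAddEquiv x y).symm)
      (fun f => by
        ext g
        exact (shiftEquiv C n).toAdjunction.homEquiv_naturality_right_symm g f)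
  exact ⟨preservesColimitsOfShape_of_natIso e⟩

variable [HasZeroObject C] [Pretriangulated C]

/-- In a triangulated category with compact generators, a morphism is invertible as soon as
composition with it is bijective on morphisms out of compact objects. -/
lemma isIso_of_bijective_of_compact
    (hC : ∃ (ι : Type v) (G : ι → C), (∀ i, IsCompactObj (G i)) ∧
      ∀ t : C, (∀ (i : ι) (f : G i ⟶ t), f = 0) → IsZero t)
    {a b : C} (φ : a ⟶ b)
    (hφ : ∀ c : C, IsCompactObj c → Function.Bijective (fun g : c ⟶ a => g ≫ φ)) : IsIso φ := by
  obtain ⟨ι, G, hG, hzero⟩ := hC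
  obtain ⟨t, ψ, δ, hT⟩ := distinguished_cocone_triangle φ
  have h₃ : IsZero t := by
    refine hzero t fun i f => ?_
    have hδ : f ≫ δ = 0 := by
      have h₁ : (f ≫ δ) ≫ φ⟦(1 : ℤ)⟧' = 0 := by
        have : δ ≫ φ⟦(1 : ℤ)⟧' = 0 := comp_distTriang_mor_zero₃₁ _ hT
        rw [Category.assoc, this, comp_zero]
      let e := shiftFunctorCompIsoId C (1 : ℤ) (-1) (by simp)
      have h₂ : ((f ≫ δ)⟦(-1 : ℤ)⟧' ≫ e.hom.app a) ≫ φ = 0 := by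
        have := e.hom.naturality φ
        dsimp at this
        rw [Category.assoc, ← this, ← Functor.map_comp_assoc, h₁, Functor.map_zero, zero_comp]
      have h₃ : (f ≫ δ)⟦(-1 : ℤ)⟧' ≫ e.hom.app a = 0 :=
        (hφ _ ((hG i).shift (-1))).1 (h₂.trans zero_comp.symm)
      apply (shiftFunctor C (-1 : ℤ)).map_injective
      rw [← cancel_mono (e.hom.app a), h₃, Functor.map_zero, zero_comp]
    obtain ⟨g, rfl⟩ := Triangle.coyoneda_exact₃ _ hT f hδ
    obtain ⟨h, rfl⟩ := (hφ _ (hG i)).2 g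
    have : φ ≫ ψ = 0 := comp_distTriang_mor_zero₁₂ _ hT
    change (h ≫ φ) ≫ ψ = 0
    rw [Category.assoc, this, comp_zero]
  exact (Triangle.isZero₃_iff_isIso₁ _ hT).1 h₃

end Detection

section Projection

variable {D : Type u₁} {C : Type u₂} [Category.{v} D] [Category.{v} C]
  [MonoidalCategory D] [MonoidalCategory C]

/-- The image of an exact pairing under a strong monoidal functor. -/
@[reducible]
def mapExactPairing (F : D ⥤ C) [F.Monoidal] (x y : D) [ExactPairing x y] :
    ExactPairing (F.obj x) (F.obj y) where
  coevaluation' := ε F ≫ F.map (η_ x y) ≫ δ F x y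
  evaluation' := μ F y x ≫ F.map (ε_ x y) ≫ Functor.OplaxMonoidal.η F
  coevaluation_evaluation' := by
    have := F.congr_map (coevaluation_evaluation x y)
    rw [Functor.Monoidal.map_associator_inv']
    simp only [MonoidalCategory.whiskerLeft_comp, comp_whiskerRight, Category.assoc,
      Functor.Monoidal.whiskerLeft_δ_μ_assoc, Functor.Monoidal.whiskerRight_δ_μ_assoc,
      μ_natural_right_assoc, δ_natural_left_assoc]
    simp only [← F.map_comp_assoc, this]
    simp
  evaluation_coevaluation' := by
    have := F.congr_map (evaluation_coevaluation x y)
    rw [Functor.Monoidal.map_associator']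
    simp only [MonoidalCategory.whiskerLeft_comp, comp_whiskerRight, Category.assoc,
      Functor.Monoidal.whiskerLeft_δ_μ_assoc, Functor.Monoidal.whiskerRight_δ_μ_assoc,
      μ_natural_left_assoc, δ_natural_right_assoc]
    simp only [← F.map_comp_assoc, this]
    simp

variable (F : D ⥤ C) [F.Monoidal] (G : C ⥤ D) [G.LaxMonoidal] (adj : F ⊣ G) [adj.IsMonoidal]

/-- The projection formula for tensoring with a dualizable object. -/
lemma isIso_projection (x : C) (e d : D) [ExactPairing e d] :
    IsIso (G.obj x ◁ adj.unit.app d ≫ μ G x (F.obj d)) := by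
  let := mapExactPairing F e d
  let π : G.obj x ⊗ d ⟶ G.obj (x ⊗ F.obj d) := G.obj x ◁ adj.unit.app d ≫ μ G x (F.obj d)
  have counit_π : F.map π ≫ adj.counit.app _ = δ F _ _ ≫ adj.counit.app x ▷ F.obj d := by
    have h (u : d ⟶ G.obj (F.obj d)) : F.map (G.obj x ◁ u ≫ μ G x (F.obj d)) ≫ adj.counit.app _ =
        δ F _ _ ≫ F.obj (G.obj x) ◁ (F.map u ≫ adj.counit.app _) ≫ adj.counit.app x ▷ F.obj d := by
      rw [F.map_comp, Category.assoc, adj.map_μ_comp_counit_app_tensor, ← δ_natural_right_assoc,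
        tensorHom_def', ← MonoidalCategory.whiskerLeft_comp_assoc]
      rfl
    simpa [π] using h (adj.unit.app d)
  have key (z : D) (v : z ⊗ e ⟶ G.obj x) :
      (adj.homEquiv _ _).symm (tensorRightHomEquiv z e d _ v ≫ π) =
        tensorRightHomEquiv _ (F.obj e) (F.obj d) _ (μ F z e ≫ (adj.homEquiv _ _).symm v) := by
    rw [adj.homEquiv_counit, F.map_comp, Category.assoc, counit_π]
    dsimp [tensorRightHomEquiv]
    rw [show η_ (F.obj e) (F.obj d) = ε F ≫ F.map (η_ e d) ≫ δ F e d from rfl,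
      adj.homEquiv_counit]
    simp only [Functor.map_comp, Category.assoc, comp_whiskerRight,
      MonoidalCategory.whiskerLeft_comp, ← δ_natural_left_assoc]
    rw [Functor.Monoidal.map_associator_inv_assoc]
    simp
  have bij (z : D) : Function.Bijective (fun u : z ⟶ G.obj x ⊗ d => u ≫ π) := by
    let E : (z ⟶ G.obj x ⊗ d) ≃ (z ⟶ G.obj (x ⊗ F.obj d)) :=
      (tensorRightHomEquiv z e d _).symm.trans <| (adj.homEquiv _ _).symm.trans <|
        (Iso.homCongr (Functor.Monoidal.μIso F z e).symm (Iso.refl x)).trans <|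
        (tensorRightHomEquiv _ (F.obj e) (F.obj d) _).trans (adj.homEquiv _ _)
    convert E.bijective with u
    obtain ⟨v, rfl⟩ := (tensorRightHomEquiv z e d _).surjective u
    apply (adj.homEquiv _ _).symm.injective
    rw [key]
    simp [E]
  exact (isIso_iff_yoneda_map_bijective π).2 bij

end Projection

section Duality

/-- An exact pairing of `x` and `y` identifies morphisms `𝟙 ⟶ y` with morphisms `x ⟶ 𝟙`. -/
lemma bijective_whiskerRight_comp_evaluation {C : Type u} [Category.{v} C] [MonoidalCategory C]
    (x y : C) [ExactPairing x y] : Function.Bijective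
      (fun s : 𝟙_ C ⟶ y => (λ_ x).inv ≫ s ▷ x ≫ ε_ x y) := by
  let E : (𝟙_ C ⟶ y) ≃ (x ⟶ 𝟙_ C) :=
    (Iso.homCongr (Iso.refl _) (λ_ y).symm).trans <| (tensorRightHomEquiv _ x y _).symm.trans
      (Iso.homCongr (λ_ x) (Iso.refl _))
  convert E.bijective with s
  simp [E, tensorRightHomEquiv, ← unitors_equal]

variable {D : Type u₁} {C : Type u₂} [Category.{v} D] [Category.{v} C]
  [MonoidalCategory D] [MonoidalCategory C]
  {F : D ⥤ C} [F.Monoidal] {G : C ⥤ D} [G.LaxMonoidal] {H : D ⥤ C}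

/-- The pairing `f_*(c') ⊗ f_*(c ⊗ ω) ⟶ 𝟙` induced by an exact pairing of `c` and `c'`. -/
def pushPairing (adj' : G ⊣ H) (c c' : C) [ExactPairing c c'] :
    G.obj c' ⊗ G.obj (c ⊗ H.obj (𝟙_ D)) ⟶ 𝟙_ D :=
  μ G _ _ ≫ G.map ((tensorLeftHomEquiv _ c c' _).symm (𝟙 _)) ≫ adj'.counit.app (𝟙_ D)

/-- The morphism `f_*(c ⊗ ω) ⟶ w ⊗ 𝟙` corresponding to `pushPairing`, where `w` is a dual
of `f_*(c')`. -/
def pushDual (adj' : G ⊣ H) (c c' : C) [ExactPairing c c'] (w : D) [ExactPairing w (G.obj c')] :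
    G.obj (c ⊗ H.obj (𝟙_ D)) ⟶ w ⊗ 𝟙_ D :=
  tensorLeftHomEquiv _ w (G.obj c') _ (pushPairing adj' c c')

/-- The pairing `pushPairing` is perfect on morphisms out of dualizable objects. -/
lemma bijective_whiskerLeft_comp_pushPairing (adj : F ⊣ G) [adj.IsMonoidal] (adj' : G ⊣ H)
    (c c' : C) [ExactPairing c c'] (e d : D) [ExactPairing e d] : Function.Bijective
      (fun t : d ⟶ G.obj (c ⊗ H.obj (𝟙_ D)) =>
        G.obj c' ◁ t ≫ pushPairing adj' c c') := by
  have := isIso_projection F G adj c' e d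
  let E : (d ⟶ G.obj (c ⊗ H.obj (𝟙_ D))) ≃ (G.obj c' ⊗ d ⟶ 𝟙_ D) :=
    (adj.homEquiv _ _).symm.trans <| (tensorLeftHomEquiv _ c c' _).symm.trans <|
      (adj'.homEquiv _ _).symm.trans <|
      Iso.homCongr (asIso (G.obj c' ◁ adj.unit.app d ≫ μ G c' (F.obj d))).symm (Iso.refl _)
  convert E.bijective with t
  obtain ⟨s, rfl⟩ := (adj.homEquiv _ _).surjective t
  have h : (tensorLeftHomEquiv _ c c' _).symm s =
      c' ◁ s ≫ (tensorLeftHomEquiv _ c c' _).symm (𝟙 _) := by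
    simp [tensorLeftHomEquiv]
  simp [E, pushPairing, Adjunction.homEquiv_unit, Adjunction.homEquiv_counit, h]

lemma bijective_comp_pushDual (adj : F ⊣ G) [adj.IsMonoidal] (adj' : G ⊣ H)
    (c c' : C) [ExactPairing c c'] (w : D) [ExactPairing w (G.obj c')]
    (e d : D) [ExactPairing e d] : Function.Bijective
      (fun t : d ⟶ G.obj (c ⊗ H.obj (𝟙_ D)) => t ≫ pushDual adj' c c' w) := by
  convert (tensorLeftHomEquiv d w (G.obj c') (𝟙_ D)).bijective.comp
    (bijective_whiskerLeft_comp_pushPairing adj adj' c c' e d) with t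
  rw [Function.comp_apply, ← Equiv.symm_apply_eq, tensorLeftHomEquiv_symm_naturality, pushDual,
    Equiv.symm_apply_apply]

/-- If `pushDual` is invertible, then tensoring with `ω` is bijective on morphisms `c ⟶ 𝟙`. -/
lemma bijective_whiskerRight_dualizing (adj : F ⊣ G) [adj.IsMonoidal] (adj' : G ⊣ H)
    (c c' : C) [ExactPairing c c'] (w : D)
    [ExactPairing w (G.obj c')] [IsIso (pushDual adj' c c' w)] : Function.Bijective
      (fun g : c ⟶ 𝟙_ C => g ▷ H.obj (𝟙_ D) ≫ (λ_ _).hom) := by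
  rw [← Function.Bijective.of_comp_iff _ (bijective_whiskerRight_comp_evaluation c c')]
  let E₁ : (𝟙_ C ⟶ c') ≃ (𝟙_ D ⟶ G.obj c') :=
    (Iso.homCongr (Functor.Monoidal.εIso F) (Iso.refl _)).trans (adj.homEquiv _ _)
  let E₂ : (w ⟶ 𝟙_ D) ≃ (c ⊗ H.obj (𝟙_ D) ⟶ H.obj (𝟙_ D)) :=
    (Iso.homCongr ((ρ_ w).symm ≪≫ (asIso (pushDual adj' c c' w)).symm) (Iso.refl _)).trans
      (adj'.homEquiv _ _)
  convert E₂.bijective.comp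
    ((bijective_whiskerRight_comp_evaluation w (G.obj c')).comp E₁.bijective) using 1
  funext s
  have hE₁ : E₁ s = ε G ≫ G.map s := by
    simp [E₁, adj.homEquiv_unit, adj.unit_app_unit_comp_map_η_assoc]
  have hs : ((λ_ c).inv ≫ s ▷ c ≫ ε_ c c') ▷ H.obj (𝟙_ D) ≫ (λ_ _).hom =
      (λ_ _).inv ≫ s ▷ _ ≫ (tensorLeftHomEquiv _ c c' _).symm (𝟙 _) := by
    simp [tensorLeftHomEquiv]
  have ht (t : 𝟙_ D ⟶ G.obj c') : pushDual adj' c c' w ≫ (ρ_ w).hom ≫ (λ_ w).inv ≫ t ▷ w ≫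
      ε_ w (G.obj c') = (λ_ _).inv ≫ t ▷ _ ≫ pushPairing adj' c c' := by
    have h : pushPairing adj' c c' =
        G.obj c' ◁ pushDual adj' c c' w ≫ (α_ _ _ _).inv ≫ ε_ _ _ ▷ _ ≫ (λ_ _).hom :=
      ((tensorLeftHomEquiv _ w (G.obj c') _).symm_apply_apply _).symm
    rw [h, ← whisker_exchange_assoc]
    monoidal
  simp only [Function.comp_apply]
  rw [hE₁, hs]
  have hE₂ (g : w ⟶ 𝟙_ D) :
      E₂ g = adj'.homEquiv _ _ (pushDual adj' c c' w ≫ (ρ_ w).hom ≫ g) := by simp [E₂]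
  rw [hE₂, ht]
  apply (adj'.homEquiv _ _).symm.injective
  rw [Equiv.symm_apply_apply]
  simp [adj'.homEquiv_counit, pushPairing, -whiskerRight_tensor]

end Duality

section Compact

variable {C : Type u} [Category.{v} C] [Preadditive C] [MonoidalCategory C] [MonoidalClosed C]

lemma RigidlyCompactlyGenerated.isCompactObj_of_exactPairing (hC : RigidlyCompactlyGenerated C)
    (y x : C) [ExactPairing y x] : IsCompactObj x :=
  (hC.compact_iff_rigid x).2 (isRigid_of_exactPairing y x)

lemma RigidlyCompactlyGenerated.exists_exactPairing (hC : RigidlyCompactlyGenerated C)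
    {x : C} (hx : IsCompactObj x) : ∃ y : C, Nonempty (ExactPairing y x) :=
  ⟨_, ⟨((hC.compact_iff_rigid x).1 hx).exactPairing⟩⟩

lemma RigidlyCompactlyGenerated.isCompactObj_unit (hC : RigidlyCompactlyGenerated C) :
    IsCompactObj (𝟙_ C) :=
  hC.isCompactObj_of_exactPairing (𝟙_ C) _

lemma RigidlyCompactlyGenerated.isCompactObj_tensor (hC : RigidlyCompactlyGenerated C) {x y : C}
    (hx : IsCompactObj x) (hy : IsCompactObj y) : IsCompactObj (x ⊗ y) := by
  obtain ⟨x', ⟨_⟩⟩ := hC.exists_exactPairing hx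
  obtain ⟨y', ⟨_⟩⟩ := hC.exists_exactPairing hy
  exact hC.isCompactObj_of_exactPairing (y' ⊗ x') _

end Compact

/-- Proposition 5.17. -/
theorem statement15 {D : Type u₁} {C : Type u₂}
    [Category.{v} D] [Preadditive D] [HasZeroObject D] [HasShift D ℤ]
    [∀ n : ℤ, (shiftFunctor D n).Additive] [Pretriangulated D] [IsTriangulated D]
    [MonoidalCategory D] [SymmetricCategory D] [MonoidalClosed D]
    [Category.{v} C] [Preadditive C] [HasZeroObject C] [HasShift C ℤ]
    [∀ n : ℤ, (shiftFunctor C n).Additive] [Pretriangulated C] [IsTriangulated C]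
    [MonoidalCategory C] [SymmetricCategory C] [MonoidalClosed C]
    (fstar : D ⥤ C) [fstar.Braided] [fstar.CommShift ℤ] [fstar.IsTriangulated]
    (hD : RigidlyCompactlyGenerated D) (hC : RigidlyCompactlyGenerated C)
    (hcop : PreservesCoproducts fstar)
    (fpush : C ⥤ D) (adj1 : fstar ⊣ fpush)
    (fone : D ⥤ C) (adj2 : fpush ⊣ fone) :
    -- (a)
    ((∀ x : C, IsCompactObj x → IsCompactObj (fpush.obj x)) ↔
      {x : C | IsCompactObj x} ⊆ compactPullback fpush {y : D | IsCompactObj y}) ∧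
    -- (b)
    ({x : C | IsCompactObj x} = compactPullback fpush {y : D | IsCompactObj y} →
      TensorInvertible (fone.obj (𝟙_ D))) := by
  have ha : (∀ x : C, IsCompactObj x → IsCompactObj (fpush.obj x)) ↔
      {x : C | IsCompactObj x} ⊆ compactPullback fpush {y : D | IsCompactObj y} :=
    ⟨fun h x hx c hc => h _ (hC.isCompactObj_tensor hc hx),
      fun h x hx => IsCompactObj.of_iso (fpush.mapIso (λ_ x)) (h hx _ hC.isCompactObj_unit)⟩
  refine ⟨ha, fun heq => ?_⟩
  have hpush := ha.2 heq.subset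
  let := adj1.rightAdjointLaxMonoidal
  have hdual (c c' : C) [ExactPairing c c'] (w : D) [ExactPairing w (fpush.obj c')] :
      IsIso (pushDual adj2 c c' w) :=
    isIso_of_bijective_of_compact hD.exists_generators _ fun d hd => by
      obtain ⟨e, ⟨_⟩⟩ := hD.exists_exactPairing hd
      exact bijective_comp_pushDual adj1 adj2 c c' w e d
  have hswap (c : C) (hc : IsCompactObj c) : ∃ (c' : C) (_ : ExactPairing c c') (w : D),
      Nonempty (ExactPairing w (fpush.obj c')) := by
    obtain ⟨c', ⟨_⟩⟩ := hC.exists_exactPairing hc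
    let := BraidedCategory.exactPairing_swap c' c
    exact ⟨c', this, hD.exists_exactPairing (hpush _ (hC.isCompactObj_of_exactPairing c c'))⟩
  have hω : IsCompactObj (fone.obj (𝟙_ D)) := by
    change _ ∈ {x : C | IsCompactObj x}
    rw [heq]
    intro c hc
    obtain ⟨c', _, w, ⟨_⟩⟩ := hswap c hc
    have := hdual c c' w
    let := BraidedCategory.exactPairing_swap w (fpush.obj c')
    exact (hD.isCompactObj_of_exactPairing (fpush.obj c') w).of_iso
      ((ρ_ w).symm ≪≫ (asIso (pushDual adj2 c c' w)).symm)
  obtain ⟨v, ⟨_⟩⟩ := hC.exists_exactPairing hω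
  let := BraidedCategory.exactPairing_swap v (fone.obj (𝟙_ D))
  have : IsIso (η_ (fone.obj (𝟙_ D)) v) :=
    isIso_of_bijective_of_compact hC.exists_generators _ fun c hc => by
      obtain ⟨c', _, w, ⟨_⟩⟩ := hswap c hc
      have := hdual c c' w
      convert (tensorRightHomEquiv c (fone.obj (𝟙_ D)) v (fone.obj (𝟙_ D))).bijective.comp
        (bijective_whiskerRight_dualizing adj1 adj2 c c' w) using 1
      funext g
      dsimp [tensorRightHomEquiv]
      rw [comp_whiskerRight, ← associator_inv_naturality_left_assoc, whisker_exchange_assoc]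
      monoidal
  exact ⟨v, ⟨(asIso (η_ (fone.obj (𝟙_ D)) v)).symm⟩⟩

end GN
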